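/- Let K and K' be half-plane hulls with ∅ ≠ K' ⊂ K, and set Ω = ℍ \ K and Ω' = ℍ \ K'. Suppose Ω is a (β,C₀)-Hölder domain and Ω is dense in Ω' (i.e., Ω' is contained in the closure of Ω). Then Ω' is a (β,C)-Hölder domain, where C > 0 depends only on β, C₀ and diam(K). -/

import Mathlib

open Set Metric Filter Bornology Complex Function

noncomputable section

/-- The upper half-plane as a subset of `ℂ`. -/
def UHP : Set ℂ := {z : ℂ | 0 < z.im}

/-- `K` is a half-plane hull: a bounded subset of the upper half-plane whose
complement in the upper half-plane is a simply connected domain. -/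
def IsHull (K : Set ℂ) : Prop :=
  IsBounded K ∧ K ⊆ UHP ∧ IsOpen (UHP \ K) ∧ IsConnected (UHP \ K) ∧
    SimplyConnectedSpace ↥(UHP \ K)

/-- `f` is the hydrodynamic conformal map of the hull `K`: a conformal bijection
from the upper half-plane onto `UHP \ K` with `f z - z → 0` as `|z| → ∞` in `UHP`. -/
def IsHydroMap (K : Set ℂ) (f : ℂ → ℂ) : Prop :=
  DifferentiableOn ℂ f UHP ∧ InjOn f UHP ∧ f '' UHP = UHP \ K ∧
    Tendsto (fun z => f z - z) (cobounded ℂ ⊓ 𝓟 UHP) (nhds (0 : ℂ))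

/-- `f` is the hydrodynamic map of `K` and `g` is its inverse. -/
def IsHydroPair (K : Set ℂ) (f g : ℂ → ℂ) : Prop :=
  IsHydroMap K f ∧ InvOn g f UHP (UHP \ K)

/-- `K` has half-plane capacity `a`, computed via its hydrodynamic map `f`:
`z * (z - f z) → a` as `|z| → ∞` in `UHP`. -/
def HasHcap (K : Set ℂ) (f : ℂ → ℂ) (a : ℝ) : Prop :=
  Tendsto (fun z => z * (z - f z)) (cobounded ℂ ⊓ 𝓟 UHP) (nhds (a : ℂ))

/-- The `(β, C₀)`-Hölder condition for a map defined on the upper half-plane. -/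
def IsHolder (f : ℂ → ℂ) (β C₀ : ℝ) : Prop :=
  ∀ z ∈ UHP, ∀ z' ∈ UHP, dist (f z) (f z') ≤ C₀ * max (dist z z' ^ β) (dist z z')

/-- The Poincaré hyperbolic distance on the upper half-plane. -/
def rhoH (z w : ℂ) : ℝ :=
  2 * Real.arsinh (dist z w / (2 * Real.sqrt (z.im * w.im)))

/-- The hyperbolic distance on a simply connected domain `Ω`, transported through a
conformal bijection `φ : UHP → Ω` (independent of the choice of `φ`). -/
def rhoVia (φ : ℂ → ℂ) (z w : ℂ) : ℝ :=
  rhoH (invFunOn φ UHP z) (invFunOn φ UHP w)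

/-- `log⁺ x = max (log x) 0`. -/
def posLog (x : ℝ) : ℝ := max (Real.log x) 0

/-- Internal distance between `A` and `B` inside `Ω`: the infimum of diameters of
connected subsets of `Ω` meeting both `A` and `B`. -/
def distIn (Ω A B : Set ℂ) : ℝ :=
  sInf {d : ℝ | ∃ E : Set ℂ, E ⊆ Ω ∧ IsConnected E ∧ (E ∩ A).Nonempty ∧
    (E ∩ B).Nonempty ∧ d = Metric.diam E}

/-- Internal diameter of `A` inside `Ω`. -/
def diamIn (Ω A : Set ℂ) : ℝ :=
  sSup {d : ℝ | ∃ a ∈ A, ∃ b ∈ A, d = distIn Ω {a} {b}}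

/-- An `L`-John curve in `Ω` with tip `z`, parametrized on `[0,1)` (the base-point,
which is not required to lie in `Ω`, corresponds to the missing endpoint). -/
def IsJohnCurve (Ω : Set ℂ) (L : ℝ) (α : ℝ → ℂ) (z : ℂ) : Prop :=
  ContinuousOn α (Ico 0 1) ∧ InjOn α (Ico 0 1) ∧ α 0 = z ∧
    MapsTo α (Ico 0 1) Ω ∧
    ∀ t ∈ Ico (0:ℝ) 1, Metric.diam (α '' Icc 0 t) ≤ L * infDist (α t) (frontier Ω)

/-- An `L`-John curve in `Ω` with tip `z` and base-point `∞`, parametrized on `[0,∞)`. -/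
def IsJohnCurveInfty (Ω : Set ℂ) (L : ℝ) (α : ℝ → ℂ) (z : ℂ) : Prop :=
  ContinuousOn α (Ici 0) ∧ InjOn α (Ici 0) ∧ α 0 = z ∧
    MapsTo α (Ici 0) Ω ∧ Tendsto α atTop (cobounded ℂ) ∧
    ∀ t ∈ Ici (0:ℝ), Metric.diam (α '' Icc 0 t) ≤ L * infDist (α t) (frontier Ω)

/-- A weak form of Bloch's theorem. -/
lemma aux_bloch {G : ℂ → ℂ} {w : ℂ} {R : ℝ} (hR : 0 < R)
    (hG : DifferentiableOn ℂ G (ball w R)) (hD : deriv G w ≠ 0) :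
    ∃ v, ball v (‖deriv G w‖ * R / 96) ⊆ G '' ball w R := by
  have hG' : DifferentiableOn ℂ (deriv G) (ball w R) := hG.deriv isOpen_ball
  have hsub : closedBall w (R / 2) ⊆ ball w R := closedBall_subset_ball (by linarith)
  have hcont : ContinuousOn (fun z => ‖deriv G z‖ * (R / 2 - dist z w)) (closedBall w (R / 2)) := by
    refine ContinuousOn.mul (hG'.continuousOn.mono hsub).norm ?_
    fun_prop
  obtain ⟨a, ha, hmax⟩ := (isCompact_closedBall w (R / 2)).exists_isMaxOn
    ⟨w, mem_closedBall_self (by linarith)⟩ hcont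
  have hw : ‖deriv G w‖ * (R / 2) ≤ ‖deriv G a‖ * (R / 2 - dist a w) := by
    have := hmax (mem_closedBall_self (by linarith) : w ∈ closedBall w (R / 2))
    simpa using this
  have hDpos : 0 < ‖deriv G w‖ := norm_pos_iff.2 hD
  set M := ‖deriv G a‖ with hM
  set s := (R / 2 - dist a w) / 2 with hs
  have hprod : 0 < M * (R / 2 - dist a w) := lt_of_lt_of_le (by positivity) hw
  have hMpos : 0 < M := by
    rcases (norm_nonneg (deriv G a)).eq_or_lt with h | h
    · rw [hM, ← h] at hprod; simp at hprod
    · exact h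
  have hspos : 0 < s := by
    have := pos_of_mul_pos_right hprod hMpos.le
    rw [hs]; linarith
  have hball : ∀ z ∈ ball a s, dist z w ≤ R / 2 - s := by
    intro z hz
    have := dist_triangle z a w
    have hz' := mem_ball.1 hz
    rw [hs] at hz' ⊢; linarith
  have hballsub : ball a s ⊆ ball w R := by
    intro z hz
    have := hball z hz
    rw [mem_ball]; linarith
  have hbd : ∀ z ∈ ball a s, ‖deriv G z‖ ≤ 2 * M := by
    intro z hz
    have h1 := hball z hz
    have h2 : ‖deriv G z‖ * (R / 2 - dist z w) ≤ M * (R / 2 - dist a w) :=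
      hmax (show z ∈ closedBall w (R / 2) by rw [mem_closedBall]; linarith)
    have h3 : ‖deriv G z‖ * s ≤ (2 * M) * s := by
      calc ‖deriv G z‖ * s ≤ ‖deriv G z‖ * (R / 2 - dist z w) := by
            gcongr; linarith
        _ ≤ _ := h2
        _ = _ := by rw [hs]; ring
    exact le_of_mul_le_mul_right h3 hspos
  have hschw : ∀ z ∈ ball a s, dist (deriv G z) (deriv G a) ≤ (3 * M) / s * dist z a := by
    intro z hz
    refine dist_le_div_mul_dist_of_mapsTo_ball (hG'.mono hballsub) ?_ hz
    intro u hu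
    rw [mem_closedBall, dist_eq_norm]
    calc _ ≤ ‖deriv G u‖ + ‖deriv G a‖ := norm_sub_le _ _
      _ ≤ 3 * M := by have := hbd u hu; rw [← hM]; linarith
  have hsub6 : closedBall a (s / 6) ⊆ ball a s := closedBall_subset_ball (by linarith)
  have hGd : ∀ z ∈ closedBall a (s / 6), DifferentiableAt ℂ G z := fun z hz =>
    hG.differentiableAt (isOpen_ball.mem_nhds (hballsub (hsub6 hz)))
  have hlin : ∀ z ∈ closedBall a (s / 6), ‖(G z - deriv G a * z) - (G a - deriv G a * a)‖
      ≤ M / 2 * ‖z - a‖ := by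
    intro z hz
    refine Convex.norm_image_sub_le_of_norm_hasDerivWithin_le (f := fun z => G z - deriv G a * z)
      (f' := fun z => deriv G z - deriv G a)
      (s := closedBall a (s / 6)) ?_ ?_ (convex_closedBall _ _)
      (mem_closedBall_self (by linarith)) hz
    · intro u hu
      have := (hGd u hu).hasDerivAt.sub ((hasDerivAt_id u).const_mul (deriv G a))
      exact (this.congr_deriv (by simp)).hasDerivWithinAt
    · intro u hu
      have h1 := hschw u (hsub6 hu)
      rw [dist_eq_norm] at h1
      refine h1.trans ?_
      have h2 := mem_closedBall.1 hu
      calc 3 * M / s * dist u a ≤ 3 * M / s * (s / 6) := by gcongr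
        _ = M / 2 := by field_simp; norm_num
  have hcov := DiffContOnCl.ball_subset_image_closedBall (f := G) (z₀ := a) (r := s / 6)
    (ε := M * s / 12) ?_ (by linarith) ?_ ?_
  · refine ⟨G a, ?_⟩
    refine (ball_subset_ball ?_).trans (hcov.trans (image_mono (hsub6.trans hballsub)))
    rw [hs]; linarith
  · refine DifferentiableOn.diffContOnCl ?_
    rw [closure_ball _ (by positivity)]
    exact fun z hz => (hGd z hz).differentiableWithinAt
  · intro z hz
    have hz' : ‖z - a‖ = s / 6 := by simpa [dist_eq_norm] using hz
    have h1 := hlin z (sphere_subset_closedBall hz)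
    have h2 : ‖deriv G a * (z - a)‖ = M * (s / 6) := by rw [norm_mul, hz']
    have h3 : deriv G a * (z - a) = (G z - G a) - ((G z - deriv G a * z) - (G a - deriv G a * a)) := by
      ring
    have h4 : ‖deriv G a * (z - a)‖ ≤ ‖G z - G a‖ +
        ‖(G z - deriv G a * z) - (G a - deriv G a * a)‖ := by
      conv_lhs => rw [h3]
      exact norm_sub_le _ _
    rw [h2] at h4; rw [hz'] at h1
    linarith
  · have hne : deriv G a ≠ 0 := norm_pos_iff.1 hMpos
    have hda := (hGd a (mem_closedBall_self (by linarith))).hasDerivAt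
    exact ((hda.eventually_ne hne (c := G a)).frequently).filter_mono nhdsWithin_le_nhds

/-- A weak form of the Koebe quarter theorem. -/
lemma aux_koebe {F : ℂ → ℂ} {w p : ℂ} {R : ℝ} (hR : 0 < R)
    (hF : DifferentiableOn ℂ F (ball w R)) (hinj : InjOn F (ball w R))
    (hp : ∀ z ∈ ball w R, F z ≠ p) :
    ‖deriv F w‖ * R ≤ 192 * Real.pi * ‖F w - p‖ := by
  have hne : ∀ z ∈ ball w R, F z - p ≠ 0 := fun z hz => sub_ne_zero.2 (hp z hz)
  have hq : DifferentiableOn ℂ (fun z => deriv F z / (F z - p)) (ball w R) :=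
    (hF.deriv isOpen_ball).div (hF.sub_const p) hne
  obtain ⟨G, hG⟩ := hq.isExactOn_ball
  have hwm : w ∈ ball w R := mem_ball_self hR
  have hGd : DifferentiableOn ℂ G (ball w R) := fun z hz =>
    (hG z hz).differentiableAt.differentiableWithinAt
  have hH : ∀ z ∈ ball w R, HasDerivAt (fun z => Complex.exp (-G z) * (F z - p)) 0 z := by
    intro z hz
    have h1 := (hG z hz).neg.cexp.mul
      ((hF.differentiableAt (isOpen_ball.mem_nhds hz)).hasDerivAt.sub_const p)
    refine h1.congr_deriv ?_
    have := hne z hz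
    field_simp
    ring
  obtain ⟨c, hc⟩ := isOpen_ball.exists_is_const_of_deriv_eq_zero
    (convex_ball w R).isPreconnected
    (fun z hz => (hH z hz).differentiableAt.differentiableWithinAt)
    (fun z hz => (hH z hz).deriv)
  have hFG : ∀ z ∈ ball w R, F z - p = c * Complex.exp (G z) := by
    intro z hz
    rw [← hc z hz]
    have : Complex.exp (-G z) * Complex.exp (G z) = 1 := by rw [← Complex.exp_add]; simp
    linear_combination (-(F z - p)) * this
  by_contra hcon
  push Not at hcon
  have hpos : 0 < ‖F w - p‖ := norm_pos_iff.2 (hne w hwm)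
  have hdG : deriv G w = deriv F w / (F w - p) := (hG w hwm).deriv
  have hbig : 192 * Real.pi < ‖deriv G w‖ * R := by
    rw [hdG, norm_div, div_mul_eq_mul_div, lt_div_iff₀ hpos]
    exact hcon
  have hD : deriv G w ≠ 0 := by
    intro h
    rw [h] at hbig
    simp at hbig
    linarith [Real.pi_pos]
  obtain ⟨v, hv⟩ := aux_bloch hR hGd hD
  have hr : 2 * Real.pi < ‖deriv G w‖ * R / 96 := by linarith
  obtain ⟨u1, hu1, e1⟩ := hv (mem_ball_self (by linarith [Real.pi_pos]) : v ∈ _)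
  obtain ⟨u2, hu2, e2⟩ := hv (show v + 2 * Real.pi * I ∈ _ by
    rw [mem_ball, dist_eq_norm]
    simpa [abs_of_pos Real.pi_pos] using hr)
  have : F u1 = F u2 := by
    have h1 := hFG u1 hu1
    have h2 := hFG u2 hu2
    rw [e1] at h1
    rw [e2, Complex.exp_add, Complex.exp_two_pi_mul_I, mul_one, ← h1] at h2
    exact (sub_left_injective h2).symm
  have h3 := hinj hu1 hu2 this
  rw [h3, e2] at e1
  simp [Real.pi_ne_zero, Complex.I_ne_zero] at e1

/-- The inverse of an injective holomorphic map is holomorphic. -/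
lemma aux_inverse {F g : ℂ → ℂ} {U : Set ℂ} (hU : IsOpen U) (hF : DifferentiableOn ℂ F U)
    (hinj : InjOn F U) (hg : LeftInvOn g F U) : ∀ w ∈ U, DifferentiableAt ℂ g (F w) := by
  have han : AnalyticOnNhd ℂ F U := hF.analyticOnNhd hU
  have hopen : ∀ w ∈ U, nhds (F w) ≤ map F (nhds w) := by
    intro w hw
    rcases (han w hw).eventually_constant_or_nhds_le_map_nhds with h | h
    · exfalso
      have h2 : ∀ᶠ z in nhdsWithin w {w}ᶜ, False := by
        filter_upwards [nhdsWithin_le_nhds h, nhdsWithin_le_nhds (hU.mem_nhds hw),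
          self_mem_nhdsWithin] with z h1 h2 h3
        exact h3 (hinj h2 hw h1)
      exact (Filter.eventually_false_iff_eq_bot.1 h2 |> (NeBot.ne inferInstance))
    · exact h
  have hcont : ∀ w ∈ U, ContinuousAt g (F w) := by
    intro w hw
    rw [ContinuousAt, hg hw]
    refine Tendsto.mono_left ?_ (hopen w hw)
    rw [tendsto_map'_iff]
    refine tendsto_id.congr' ?_
    filter_upwards [hU.mem_nhds hw] with z hz
    simp [hg hz]
  have himg : ∀ w ∈ U, ∀ᶠ y in nhds (F w), ∃ z ∈ U, F z = y := by
    intro w hw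
    have : F '' U ∈ map F (nhds w) := image_mem_map (hU.mem_nhds hw)
    exact hopen w hw this
  have hdiff : ∀ w ∈ U, deriv F w ≠ 0 → DifferentiableAt ℂ g (F w) := by
    intro w hw h
    have hd : HasDerivAt F (deriv F w) (g (F w)) := by
      rw [hg hw]; exact (han w hw).differentiableAt.hasDerivAt
    refine (HasDerivAt.of_local_left_inverse (hcont w hw) hd h ?_).differentiableAt
    filter_upwards [himg w hw] with y ⟨z, hz, e⟩
    rw [← e, hg hz]
  intro w hw
  rcases (han w hw).deriv.eventually_eq_zero_or_eventually_ne_zero with h | h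
  · exfalso
    obtain ⟨ε, hε, hb⟩ := Metric.eventually_nhds_iff_ball.1 (h.and (hU.mem_nhds hw))
    have hconst := isOpen_ball.is_const_of_deriv_eq_zero (convex_ball w ε).isPreconnected
      (hF.mono fun z hz => (hb z hz).2) (fun z hz => (hb z hz).1)
      (x := w) (y := w + (ε / 2 : ℝ)) (mem_ball_self hε)
      (by rw [mem_ball, dist_eq_norm]; simp only [add_sub_cancel_left, norm_real, Real.norm_eq_abs];
          rw [abs_of_pos] <;> linarith)
    have := hinj hw (hb (w + (ε / 2 : ℝ)) (by
      rw [mem_ball, dist_eq_norm]; simp only [add_sub_cancel_left, norm_real, Real.norm_eq_abs];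
      rw [abs_of_pos] <;> linarith)).2 hconst
    have h2 : ((ε / 2 : ℝ) : ℂ) = 0 := by linear_combination -this
    have : ε / 2 = 0 := by exact_mod_cast h2
    linarith
  · refine (analyticAt_of_differentiable_on_punctured_nhds_of_continuousAt ?_
      (hcont w hw)).differentiableAt
    have hg0 : Tendsto g (nhdsWithin (F w) {F w}ᶜ) (nhdsWithin w {w}ᶜ) := by
      refine tendsto_nhdsWithin_iff.2 ⟨?_, ?_⟩
      · have := (hcont w hw).tendsto
        rw [hg hw] at this
        exact this.mono_left nhdsWithin_le_nhds
      · filter_upwards [nhdsWithin_le_nhds (himg w hw), self_mem_nhdsWithin] with y ⟨z, hz, e⟩ hy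
        intro h
        rw [← e, hg hz] at h
        apply hy
        rw [← e, h]; rfl
    filter_upwards [hg0.eventually h, nhdsWithin_le_nhds (himg w hw)] with y hy ⟨z, hz, e⟩
    rw [← e, hg hz] at hy
    rw [← e]
    exact hdiff z hz hy

lemma aux_isOpen_UHP : IsOpen UHP := isOpen_lt continuous_const Complex.continuous_im

lemma aux_far_connected {R : ℝ} (hR : 0 < R) : IsPreconnected {ζ : ℂ | ζ ∈ UHP ∧ R < ‖ζ‖} := by
  have h : {ζ : ℂ | ζ ∈ UHP ∧ R < ‖ζ‖} =
      Complex.exp '' {z : ℂ | Real.log R < z.re ∧ (0 < z.im ∧ z.im < Real.pi)} := by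
    ext ζ
    constructor
    · rintro ⟨h1, h2⟩
      have h1' : 0 < ζ.im := h1
      have h0 : ζ ≠ 0 := by rintro rfl; simp at h1'
      refine ⟨Complex.log ζ, ⟨?_, ?_, ?_⟩, Complex.exp_log h0⟩
      · rw [Complex.log_re]; exact Real.log_lt_log hR h2
      · rw [Complex.log_im]
        refine lt_of_le_of_ne (Complex.arg_nonneg_iff.2 h1'.le) ?_
        intro h
        have := (Complex.arg_eq_zero_iff.1 h.symm).2
        linarith
      · rw [Complex.log_im]
        exact lt_of_le_of_ne (Complex.arg_le_pi _) fun h => by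
          have := (Complex.arg_eq_pi_iff.1 h).2
          linarith
    · rintro ⟨z, ⟨h1, h2, h3⟩, rfl⟩
      refine ⟨?_, ?_⟩
      · show 0 < (Complex.exp z).im
        rw [Complex.exp_im]
        exact mul_pos (Real.exp_pos _) (Real.sin_pos_of_pos_of_lt_pi h2 h3)
      · rw [Complex.norm_exp]
        exact (Real.log_lt_iff_lt_exp hR).1 h1
  rw [h]
  refine IsPreconnected.image ?_ _ Complex.continuous_exp.continuousOn
  refine Convex.isPreconnected ?_
  refine (convex_halfSpace_re_gt _).inter ((convex_halfSpace_im_gt _).inter (convex_halfSpace_im_lt _))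

lemma aux_tend {K : Set ℂ} {f : ℂ → ℂ} (h : IsHydroMap K f) {ε : ℝ} (hε : 0 < ε) :
    ∃ R > 0, ∀ z ∈ UHP, R ≤ ‖z‖ → ‖f z - z‖ < ε := by
  have h1 := (Metric.tendsto_nhds.1 h.2.2.2) ε hε
  rw [eventually_inf_principal] at h1
  obtain ⟨R, -, hR⟩ := (hasBasis_cobounded_norm (E := ℂ)).eventually_iff.1 h1
  refine ⟨max R 1, by positivity, fun z hz hzR => ?_⟩
  simpa using hR (show R ≤ ‖z‖ from (le_max_left _ _).trans hzR) hz

lemma aux_far {K : Set ℂ} {F g : ℂ → ℂ} (hK : IsBounded K) (h : IsHydroPair K F g)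
    {ε : ℝ} (hε : 0 < ε) : ∃ R, ∀ w ∈ UHP, R < ‖F w‖ → ‖F w - w‖ < ε := by
  obtain ⟨R1, hR1, hR1'⟩ := aux_tend h.1 (lt_min hε one_pos)
  obtain ⟨R2, hR2⟩ := hK.subset_closedBall 0
  set R := max (R1 + 1) R2 with hR
  have hRpos : 0 < R := lt_of_lt_of_le (by linarith) (le_max_left _ _)
  have hinv := aux_inverse aux_isOpen_UHP h.1.1 h.1.2.1 h.2.1
  set U := {ζ : ℂ | ζ ∈ UHP ∧ R < ‖ζ‖} with hU
  have hUsub : U ⊆ F '' UHP := by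
    rw [h.1.2.2.1]
    rintro ζ ⟨h1, h2⟩
    refine ⟨h1, fun hk => ?_⟩
    have := hR2 hk
    rw [mem_closedBall, dist_zero_right] at this
    exact absurd (this.trans (le_max_right (R1 + 1) R2)) (not_le.2 h2)
  have hconn : IsPreconnected (g '' U) := by
    refine (aux_far_connected hRpos).image _ ?_
    intro ζ hζ
    obtain ⟨w, hw, rfl⟩ := hUsub hζ
    exact (hinv w hw).continuousAt.continuousWithinAt
  have hsub := hconn.subset_or_subset (u := {w : ℂ | ‖w‖ < R1}) (v := {w : ℂ | R1 < ‖w‖})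
    (isOpen_lt continuous_norm continuous_const) (isOpen_lt continuous_const continuous_norm)
    (by
      rw [Set.disjoint_left]
      intro w h1 h2
      exact lt_asymm (show ‖w‖ < R1 from h1) (show R1 < ‖w‖ from h2))
    (by
      rintro _ ⟨ζ, hζ, rfl⟩
      obtain ⟨w, hw, rfl⟩ := hUsub hζ
      rw [h.2.1 hw]
      rcases lt_trichotomy ‖w‖ R1 with h1 | h1 | h1
      · exact Or.inl h1
      · exfalso
        have h2 := (hR1' w hw h1.ge).trans_le (min_le_right _ _)
        have h3 : ‖F w‖ ≤ ‖F w - w‖ + ‖w‖ := by simpa using norm_add_le (F w - w) w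
        have h4 := hζ.2
        have h5 := le_max_left (R1 + 1) R2
        linarith
      · exact Or.inr h1)
  have hFU : ∀ w ∈ UHP, F w ∈ UHP := fun w hw => by
    have : F w ∈ F '' UHP := mem_image_of_mem _ hw
    rw [h.1.2.2.1] at this
    exact this.1
  have hsub2 : g '' U ⊆ {w : ℂ | R1 < ‖w‖} := by
    rcases hsub with h1 | h1
    · exfalso
      set w : ℂ := ((R + R1 + 2 : ℝ) : ℂ) * I with hw
      have hwn : ‖w‖ = R + R1 + 2 := by
        rw [hw, norm_mul, norm_I, mul_one, norm_real, Real.norm_eq_abs, abs_of_pos]; linarith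
      have hwU : w ∈ UHP := by
        show 0 < w.im
        rw [hw, Complex.mul_I_im, Complex.ofReal_re]; linarith
      have h2 := (hR1' w hwU (by linarith)).trans_le (min_le_right _ _)
      have h3 : ‖w‖ ≤ ‖F w‖ + ‖F w - w‖ := by simpa using norm_sub_le (F w) (F w - w)
      have h4 : g (F w) ∈ {w : ℂ | ‖w‖ < R1} :=
        h1 (mem_image_of_mem _ ⟨hFU w hwU, by linarith⟩)
      rw [h.2.1 hwU] at h4
      have : ‖w‖ < R1 := h4
      linarith
    · exact h1
  refine ⟨R, fun w hw hwR => ?_⟩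
  have h1 : g (F w) ∈ {w : ℂ | R1 < ‖w‖} := hsub2 (mem_image_of_mem _ ⟨hFU w hw, hwR⟩)
  rw [h.2.1 hw] at h1
  exact (hR1' w hw (le_of_lt h1)).trans_le (min_le_left _ _)

lemma aux_im {K K' : Set ℂ} {f F G : ℂ → ℂ} (hKK : K' ⊆ K) (hK' : IsBounded K')
    (hf : IsHydroMap K f) (hF : IsHydroPair K' F G) :
    ∀ z ∈ UHP, G (f z) ∈ UHP ∧ F (G (f z)) = f z ∧ z.im ≤ (G (f z)).im := by
  have hmem : ∀ z ∈ UHP, ∃ w ∈ UHP, F w = f z := by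
    intro z hz
    have h1 : f z ∈ f '' UHP := mem_image_of_mem _ hz
    rw [hf.2.2.1] at h1
    have h2 : f z ∈ F '' UHP := by
      rw [hF.1.2.2.1]; exact ⟨h1.1, fun h => h1.2 (hKK h)⟩
    exact h2
  have hinv := aux_inverse aux_isOpen_UHP hF.1.1 hF.1.2.1 hF.2.1
  have hGU : ∀ z ∈ UHP, G (f z) ∈ UHP ∧ F (G (f z)) = f z := by
    intro z hz
    obtain ⟨w, hw, e⟩ := hmem z hz
    rw [← e, hF.2.1 hw]; exact ⟨hw, rfl⟩
  have hdiff : DifferentiableOn ℂ (fun z => G (f z)) UHP := by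
    intro z hz
    obtain ⟨w, hw, e⟩ := hmem z hz
    have h1 := hinv w hw
    rw [e] at h1
    exact (h1.comp z (hf.1.differentiableAt
      (aux_isOpen_UHP.mem_nhds hz))).differentiableWithinAt
  intro z0 hz0
  refine ⟨(hGU z0 hz0).1, (hGU z0 hz0).2, ?_⟩
  have hz0' : 0 < z0.im := hz0
  refine le_of_forall_pos_le_add fun δ' hδ' => ?_
  obtain ⟨δ, hδ, hδ1, hδ2⟩ : ∃ δ > 0, δ < z0.im ∧ δ ≤ δ' :=
    ⟨min (z0.im / 2) δ', by positivity, lt_of_le_of_lt (min_le_left _ _) (by linarith),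
      min_le_right _ _⟩
  obtain ⟨R1, hR1, hR1'⟩ := aux_tend hf (half_pos hδ)
  obtain ⟨R2, hR2⟩ := aux_far hK' hF (half_pos hδ)
  have hfar : ∀ z ∈ UHP, R1 + |R2| + δ < ‖z‖ → ‖G (f z) - z‖ < δ := by
    intro z hz hzn
    have h1 := hR1' z hz (by linarith [abs_nonneg R2])
    have h2 : ‖z‖ ≤ ‖f z‖ + ‖f z - z‖ := by simpa using norm_sub_le (f z) (f z - z)
    have h3 := hR2 (G (f z)) (hGU z hz).1 (by
      rw [(hGU z hz).2]; linarith [le_abs_self R2])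
    rw [(hGU z hz).2] at h3
    have h4 : ‖G (f z) - z‖ ≤ ‖f z - z‖ + ‖f z - G (f z)‖ := by
      simpa using norm_sub_le (f z - z) (f z - G (f z))
    linarith
  set R := R1 + |R2| + δ + ‖z0‖ + 1 with hR
  set U : Set ℂ := {z : ℂ | δ < z.im} ∩ ball 0 R with hU
  have hUo : IsOpen U := (isOpen_lt continuous_const Complex.continuous_im).inter isOpen_ball
  have hcl : closure U ⊆ {z : ℂ | δ ≤ z.im} ∩ closedBall 0 R := by
    refine closure_minimal ?_ ((isClosed_le continuous_const Complex.continuous_im).inter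
      isClosed_closedBall)
    rintro z ⟨h1, h2⟩
    exact ⟨(le_of_lt h1 : δ ≤ z.im), ball_subset_closedBall h2⟩
  have hclU : closure U ⊆ UHP := fun z hz => lt_of_lt_of_le hδ (hcl hz).1
  have hnorm : ∀ z, ‖Complex.exp (I * (G (f z) - z))‖ = Real.exp (z.im - (G (f z)).im) := by
    intro z
    rw [Complex.norm_exp]
    congr 1
    simp
  have hmax := Complex.norm_le_of_forall_mem_frontier_norm_le (U := U)
    (f := fun z => Complex.exp (I * (G (f z) - z))) (C := Real.exp δ)
    (isBounded_ball.subset inter_subset_right) ?_ ?_ (z := z0) (subset_closure ⟨hδ1, ?_⟩)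
  · simp only [hnorm, Real.exp_le_exp] at hmax
    linarith
  · refine DifferentiableOn.diffContOnCl ?_
    exact (((hdiff.mono hclU).sub differentiableOn_id).const_mul I).cexp
  · intro z hz
    simp only [hnorm, Real.exp_le_exp]
    have hzc := hcl hz.1
    have hzU : z ∈ UHP := hclU hz.1
    have hGpos : 0 < (G (f z)).im := (hGU z hzU).1
    have hnot : z ∉ U := fun h => hz.2 (hUo.interior_eq.symm ▸ h)
    by_cases hd : δ < z.im
    · have h1 : R ≤ ‖z‖ := by
        by_contra hlt
        exact hnot ⟨hd, by rw [mem_ball, dist_zero_right]; exact not_le.1 hlt⟩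
      have h2 := hfar z hzU (by linarith [norm_nonneg z0])
      have h3 := (abs_im_le_norm (G (f z) - z)).trans h2.le
      rw [Complex.sub_im] at h3
      linarith [neg_abs_le ((G (f z)).im - z.im)]
    · linarith
  · rw [mem_ball, dist_zero_right]
    linarith [abs_nonneg R2]

lemma aux_schwarz {F G : ℂ → ℂ} (hF : DifferentiableOn ℂ F UHP) (hinj : InjOn F UHP)
    (hG : LeftInvOn G F UHP) {w : ℂ} (hw : w ∈ UHP) {r : ℝ} (hr : 0 < r)
    (hball : ball (F w) r ⊆ F '' UHP) {u : ℂ} (hu : u ∈ UHP) (hur : dist (F u) (F w) ≤ r / 2) :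
    u.im ≤ 3 * w.im := by
  have hw' : 0 < w.im := hw
  have hu' : 0 < u.im := hu
  have hinv := aux_inverse aux_isOpen_UHP hF hinj hG
  have hne : ∀ v ∈ UHP, v - (starRingEnd ℂ) w ≠ 0 := by
    intro v hv h
    have h1 : 0 < v.im := hv
    have := congrArg Complex.im h
    simp at this
    linarith
  have hsq : ∀ v : ℂ, ‖v - w‖ ^ 2 = (v.re - w.re) ^ 2 + (v.im - w.im) ^ 2 := by
    intro v; rw [Complex.sq_norm, Complex.normSq_apply]; simp; ring
  have hsq' : ∀ v : ℂ, ‖v - (starRingEnd ℂ) w‖ ^ 2 = (v.re - w.re) ^ 2 + (v.im + w.im) ^ 2 := by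
    intro v; rw [Complex.sq_norm, Complex.normSq_apply]; simp; ring
  have hle : ∀ v ∈ UHP, ‖(v - w) / (v - (starRingEnd ℂ) w)‖ ≤ 1 := by
    intro v hv
    have hv' : 0 < v.im := hv
    rw [norm_div, div_le_one (norm_pos_iff.2 (hne v hv))]
    refine le_of_sq_le_sq ?_ (norm_nonneg _)
    rw [hsq, hsq']
    nlinarith [mul_pos hv' hw']
  have hmem : F u ∈ ball (F w) r := by rw [mem_ball]; linarith
  have h := dist_le_div_mul_dist_of_mapsTo_ball
    (f := fun ζ => (G ζ - w) / (G ζ - (starRingEnd ℂ) w)) (c := F w) (R₁ := r) (R₂ := 1)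
    ?_ ?_ hmem
  · simp only [hG hw, hG hu, sub_self, zero_div, dist_zero_right] at h
    have h2 : ‖(u - w) / (u - (starRingEnd ℂ) w)‖ ≤ 1 / 2 := by
      refine h.trans ?_
      calc 1 / r * dist (F u) (F w) ≤ 1 / r * (r / 2) := by gcongr
        _ = 1 / 2 := by field_simp
    rw [norm_div, div_le_iff₀ (norm_pos_iff.2 (hne u hu))] at h2
    have h3 : ‖u - w‖ ^ 2 ≤ (1 / 2 * ‖u - (starRingEnd ℂ) w‖) ^ 2 := by gcongr
    rw [mul_pow, hsq, hsq'] at h3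
    by_contra hcon
    push Not at hcon
    nlinarith [sq_nonneg (u.re - w.re)]
  · intro ζ hζ
    obtain ⟨v, hv, rfl⟩ := hball hζ
    have h1 := hinv v hv
    refine DifferentiableAt.differentiableWithinAt ?_
    refine (h1.sub_const w).div (h1.sub_const _) ?_
    rw [hG hv]; exact hne v hv
  · intro ζ hζ
    obtain ⟨v, hv, rfl⟩ := hball hζ
    simp only [hG hw, hG hv, sub_self, zero_div, mem_closedBall, dist_zero_right]
    exact hle v hv

lemma aux_hardy {F : ℂ → ℂ} {β A : ℝ} (hβ0 : 0 < β) (hβ1 : β ≤ 1) (hA : 0 ≤ A)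
    (hF : DifferentiableOn ℂ F UHP)
    (hd : ∀ w ∈ UHP, ‖deriv F w‖ ≤ A * (w.im ^ (β - 1) + 1)) :
    IsHolder F β (A * (2 / β + 4)) := by
  have hFd : ∀ w ∈ UHP, DifferentiableAt ℂ F w := fun w hw =>
    hF.differentiableAt (aux_isOpen_UHP.mem_nhds hw)
  have hvert : ∀ w ∈ UHP, ∀ δ > 0, ‖F (w + (δ : ℝ) * I) - F w‖ ≤ A * (δ ^ β / β + δ) := by
    intro w hw δ hδ
    have hw' : 0 < w.im := hw
    have hpath : ∀ s : ℝ, 0 ≤ s → w + (s : ℝ) * I ∈ UHP := by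
      intro s hs
      show 0 < (w + (s : ℝ) * I).im
      simp; linarith
    have hder : ∀ s : ℝ, 0 ≤ s → HasDerivAt (fun s : ℝ => F (w + (s : ℝ) * I) - F w)
        (deriv F (w + (s : ℝ) * I) * I) s := by
      intro s hs
      have h1 : HasDerivAt (fun s : ℝ => w + (s : ℂ) * I) I s := by
        have := ((Complex.ofRealCLM.hasDerivAt (x := s)).mul_const I).const_add w
        simpa using this
      exact ((hFd _ (hpath s hs)).hasDerivAt.comp s h1).sub_const _
    have hB : ∀ s : ℝ, 0 ≤ s → HasDerivAt
        (fun s : ℝ => A * (((w.im + s) ^ β - w.im ^ β) / β + s))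
        (A * ((w.im + s) ^ (β - 1) + 1)) s := by
      intro s hs
      have h1 := ((hasDerivAt_id s).const_add w.im).rpow_const (p := β)
        (Or.inl (by simp; linarith))
      have h2 := (((h1.sub_const (w.im ^ β)).div_const β).add (hasDerivAt_id s)).const_mul A
      refine h2.congr_deriv ?_
      simp only [id]
      field_simp
    have := image_norm_le_of_norm_deriv_right_le_deriv_boundary' (a := 0) (b := δ)
      (f := fun s : ℝ => F (w + (s : ℝ) * I) - F w)
      (fun s hs => (hder s hs.1).continuousAt.continuousWithinAt)
      (fun s hs => (hder s hs.1).hasDerivWithinAt) (by simp)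
      (fun s hs => (hB s hs.1).continuousAt.continuousWithinAt)
      (fun s hs => (hB s hs.1).hasDerivWithinAt)
      (by
        intro s hs
        rw [norm_mul, norm_I, mul_one]
        have := hd _ (hpath s hs.1)
        simpa using this) (right_mem_Icc.2 hδ.le)
    refine this.trans ?_
    have hsub : (w.im + δ) ^ β ≤ w.im ^ β + δ ^ β :=
      Real.rpow_add_le_add_rpow hw'.le hδ.le hβ0.le hβ1
    gcongr
    linarith
  intro z hz z' hz'
  rcases eq_or_ne z z' with rfl | hne
  · simp only [dist_self]; positivity
  have hz0 : 0 < z.im := hz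
  have hz0' : 0 < z'.im := hz'
  set δ := dist z z' with hδ
  have hδ0 : 0 < δ := dist_pos.2 hne
  have h1 := hvert z hz δ hδ0
  have h2 := hvert z' hz' δ hδ0
  have h3 : ‖F (z' + (δ : ℝ) * I) - F (z + (δ : ℝ) * I)‖ ≤ A * (δ ^ (β - 1) + 1) * δ := by
    have := Convex.norm_image_sub_le_of_norm_deriv_le (f := F) (s := {w : ℂ | δ ≤ w.im})
      (C := A * (δ ^ (β - 1) + 1))
      (fun w hw => hFd w (lt_of_lt_of_le hδ0 hw))
      (fun w hw => (hd w (lt_of_lt_of_le hδ0 hw)).trans (by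
        have : w.im ^ (β - 1) ≤ δ ^ (β - 1) :=
          Real.rpow_le_rpow_of_nonpos hδ0 hw (by linarith)
        gcongr))
      (convex_halfSpace_im_ge δ)
      (x := z + (δ : ℝ) * I) (y := z' + (δ : ℝ) * I)
      (by simp; linarith) (by simp; linarith)
    refine this.trans_eq ?_
    congr 1
    rw [hδ, dist_comm, dist_eq_norm]
    congr 1; ring
  have h4 : δ ^ (β - 1) * δ = δ ^ β := by
    rw [Real.rpow_sub_one hδ0.ne']; field_simp
  have h5 : dist (F z) (F z') ≤ ‖F (z + (δ : ℝ) * I) - F z‖ + ‖F (z' + (δ : ℝ) * I) - F z'‖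
      + ‖F (z' + (δ : ℝ) * I) - F (z + (δ : ℝ) * I)‖ := by
    rw [dist_eq_norm]
    have e : F z - F z' = (F (z' + (δ : ℝ) * I) - F z') - (F (z + (δ : ℝ) * I) - F z)
      - (F (z' + (δ : ℝ) * I) - F (z + (δ : ℝ) * I)) := by ring
    rw [e]
    have a1 := norm_sub_le ((F (z' + (δ : ℝ) * I) - F z') - (F (z + (δ : ℝ) * I) - F z))
      (F (z' + (δ : ℝ) * I) - F (z + (δ : ℝ) * I))
    have a2 := norm_sub_le (F (z' + (δ : ℝ) * I) - F z') (F (z + (δ : ℝ) * I) - F z)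
    linarith
  have hm1 := le_max_left (δ ^ β) δ
  have hm2 := le_max_right (δ ^ β) δ
  set m := max (δ ^ β) δ with hm
  calc dist (F z) (F z') ≤ A * (2 * (δ ^ β / β + δ) + δ ^ (β - 1) * δ + δ) := by linarith
    _ ≤ A * (2 * (m / β + m) + m + m) := by rw [h4]; gcongr
    _ = A * (2 / β + 4) * m := by ring

lemma aux_deriv {K K' : Set ℂ} {f F G : ℂ → ℂ} {β C₀ : ℝ} (hβ0 : 0 < β) (hβ1 : β ≤ 1)
    (hC₀ : 0 < C₀) (hKK : K' ⊆ K) (hK' : IsBounded K')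
    (hf : IsHydroMap K f) (hF : IsHydroPair K' F G) (hH : IsHolder f β C₀)
    (hdense : UHP \ K' ⊆ closure (UHP \ K)) :
    ∀ w ∈ UHP, ‖deriv F w‖ ≤ (192 * Real.pi * (16 * C₀)) * (w.im ^ (β - 1) + 1) := by
  intro w hw
  have hw' : 0 < w.im := hw
  set y := w.im with hy
  have hKimg : F '' UHP = UHP \ K' := hF.1.2.2.1
  have hopen : IsOpen (F '' UHP) := by
    have hinv := aux_inverse aux_isOpen_UHP hF.1.1 hF.1.2.1 hF.2.1
    rcases (hF.1.1.analyticOnNhd aux_isOpen_UHP).is_constant_or_isOpen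
      (convex_halfSpace_im_gt 0).isPreconnected with ⟨c, hc⟩ | h
    · exfalso
      have hm : ∀ t : ℝ, 0 < t → (t : ℂ) * I ∈ UHP := by
        intro t ht
        show 0 < ((t : ℂ) * I).im
        simpa using ht
      have := hF.1.2.1 (hm 1 one_pos) (hm 2 two_pos)
        ((hc _ (hm 1 one_pos)).trans (hc _ (hm 2 two_pos)).symm)
      simp [Complex.ext_iff] at this
    · exact h _ Subset.rfl aux_isOpen_UHP
  have hne : (F '' UHP)ᶜ.Nonempty := ⟨0, by
    rw [hKimg]
    intro h
    have : (0:ℝ) < (0 : ℂ).im := h.1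
    simp at this⟩
  obtain ⟨p, hp, hpr⟩ := hopen.isClosed_compl.exists_infDist_eq_dist hne (F w)
  set r := infDist (F w) (F '' UHP)ᶜ with hr
  have hFw : F w ∈ F '' UHP := mem_image_of_mem _ hw
  have hr0 : 0 < r := by
    rw [hpr]; exact dist_pos.2 fun h => hp (h ▸ hFw)
  have hball : ball (F w) r ⊆ F '' UHP := ball_infDist_compl_subset
  have hsub : ball w y ⊆ UHP := by
    intro u hu
    rw [mem_ball, dist_eq_norm] at hu
    have h1 := (abs_im_le_norm (u - w)).trans_lt hu
    rw [Complex.sub_im] at h1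
    show 0 < u.im
    linarith [neg_abs_le (u.im - w.im)]
  have hk := aux_koebe hw' (hF.1.1.mono hsub) (hF.1.2.1.mono hsub)
    (p := p) (fun z hz h => hp (h ▸ mem_image_of_mem _ (hsub hz)))
  rw [← dist_eq_norm, ← hpr] at hk
  have hrle : r ≤ 16 * C₀ * max (y ^ β) y := by
    by_contra hcon
    push Not at hcon
    have h1 : F w ∈ closure (f '' UHP) := by
      rw [hf.2.2.1]; exact hdense (hKimg ▸ hFw)
    obtain ⟨_, ⟨z, hz, rfl⟩, hzd⟩ := Metric.mem_closure_iff.1 h1 (r / 4) (by linarith)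
    have hz' : 0 < z.im := hz
    have hzt : z + ((4 * y : ℝ) : ℂ) * I ∈ UHP := by
      show 0 < (z + ((4 * y : ℝ) : ℂ) * I).im
      rw [Complex.add_im, Complex.mul_I_im, Complex.ofReal_re]; linarith
    have h2 := hH _ hzt z hz
    have h3 : dist (z + ((4 * y : ℝ) : ℂ) * I) z = 4 * y := by
      rw [dist_eq_norm, add_sub_cancel_left, norm_mul, norm_I, mul_one, norm_real,
        Real.norm_eq_abs, abs_of_pos]
      linarith
    rw [h3] at h2
    have h4 : max ((4 * y) ^ β) (4 * y) ≤ 4 * max (y ^ β) y := by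
      refine max_le ?_ ?_
      · rw [Real.mul_rpow (by norm_num) hw'.le]
        have : (4:ℝ) ^ β ≤ 4 := by
          simpa using Real.rpow_le_rpow_of_exponent_le (by norm_num : (1:ℝ) ≤ 4) hβ1
        have h6 := le_max_left (y ^ β) y
        gcongr
      · have := le_max_right (y ^ β) y
        linarith
    have h5 : C₀ * max ((4 * y) ^ β) (4 * y) ≤ C₀ * (4 * max (y ^ β) y) := by gcongr
    obtain ⟨b1, b2, b3⟩ := aux_im hKK hK' hf hF _ hzt
    have h6 := aux_schwarz hF.1.1 hF.1.2.1 hF.2.1 hw hr0 hball b1 (by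
      rw [b2]
      have := dist_triangle (f (z + ((4 * y : ℝ) : ℂ) * I)) (f z) (F w)
      rw [dist_comm (f z) (F w)] at this
      linarith)
    rw [Complex.add_im, Complex.mul_I_im, Complex.ofReal_re] at b3
    linarith
  have hm : max (y ^ β) y ≤ (y ^ (β - 1) + 1) * y := by
    have h4 : y ^ (β - 1) * y = y ^ β := by
      rw [Real.rpow_sub_one hw'.ne']; field_simp
    have h5 : 0 ≤ y ^ β := by positivity
    rw [add_mul, h4, one_mul]
    exact max_le (by linarith) (by linarith)
  refine le_of_mul_le_mul_right ?_ hw'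
  calc ‖deriv F w‖ * y ≤ 192 * Real.pi * r := hk
    _ ≤ 192 * Real.pi * (16 * C₀ * max (y ^ β) y) := by gcongr
    _ ≤ 192 * Real.pi * (16 * C₀ * ((y ^ (β - 1) + 1) * y)) := by gcongr
    _ = _ := by ring

/-- **Lemma `dense`.** If `Ω = ℍ \ K` is a `(β,C₀)`-Hölder domain dense
in `Ω' = ℍ \ K'` (with `∅ ≠ K' ⊆ K`), then `Ω'` is a `(β,C)`-Hölder domain with `C`
depending only on `β`, `C₀` and `diam K`. -/
theorem holder_of_dense_subdomain (β C₀ d : ℝ) (hβ0 : 0 < β) (hβ1 : β ≤ 1)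
    (hC₀ : 0 < C₀) :
    ∃ C > 0, ∀ (K K' : Set ℂ) (f g f' g' : ℂ → ℂ),
      IsHull K → IsHull K' → K'.Nonempty → K' ⊆ K →
      Metric.diam K = d →
      IsHydroPair K f g → IsHydroPair K' f' g' →
      IsHolder f β C₀ →
      UHP \ K' ⊆ closure (UHP \ K) →
      IsHolder f' β C := by
  have hpi := Real.pi_pos
  refine ⟨(192 * Real.pi * (16 * C₀)) * (2 / β + 4), by positivity, ?_⟩
  intro K K' f g f' g' hK hK' hne hsub hd hf hf' hH hdense
  exact aux_hardy hβ0 hβ1 (by positivity) hf'.1.1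
    (aux_deriv hβ0 hβ1 hC₀ hsub hK'.1 hf.1 hf' hH hdense)
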